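/- Suppose o : A →α A' and o' : A →β A'' are coinitial combined annotation transitions with α ι_lab β. Write diff(o) = (ΔV^α, ΔE_R^α, ΔE_W^α) and diff(o') = (ΔV^β, ΔE_R^β, ΔE_W^β). Then ΔV^α ∩ ΔV^β = ∅, ΔE_R^α ∩ ΔE_R^β = ∅, and ΔE_W^α ∩ ΔE_W^β = ∅. -/

import Mathlib

namespace CRIL

/-- Process identifiers: finite lists of positive integers. -/
abbrev PID := List ℕ+

/-- Nodes of an annotation DAG: either ⊥ or a pair (p, n). -/
inductive ANode where
  | bot : ANode
  | node : PID → ℕ → ANode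
deriving DecidableEq

/-- Labeled edges. -/
abbrev AEdge (R : Type) := ANode × R × ANode

/-- Annotation DAGs, with the five defining conditions. -/
structure AnnDAG (R : Type) where
  V : Set ANode
  ER : Set (AEdge R)
  EW : Set (AEdge R)
  finV : V.Finite
  bot_mem : ANode.bot ∈ V
  down : ∀ p n, ANode.node p n ∈ V → ∀ n' ≤ n, ANode.node p n' ∈ V
  edges_sub : ∀ e ∈ ER ∪ EW, e.1 ∈ V ∧ e.2.2 ∈ V
  in_unique : ∀ v' v'' r v, (v', r, v) ∈ ER ∪ EW → (v'', r, v) ∈ ER ∪ EW → v' = v''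
  disj : ER ∩ EW = ∅
  acyclic : ∀ v, ¬ Relation.TransGen (fun a b => ∃ r, (a, r, b) ∈ ER ∪ EW) v v
  w_pred : ∀ v' r v, (v', r, v) ∈ EW → v' ≠ ANode.bot → ∃ v'', (v'', r, v') ∈ EW
  w_out_unique : ∀ v r v' v'', (v, r, v') ∈ EW → (v, r, v'') ∈ EW → v' = v''

-- `last(r, E_W)`: the final node of the unique maximal chain of `r`-labeled
-- `E_W`-edges starting at ⊥ (⊥ if there is no such edge).
open Classical in
noncomputable def lastN {R : Type} (EW : Set (AEdge R)) (r : R) : ANode :=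
  if h : ∃! v, Relation.ReflTransGen (fun a b => (a, r, b) ∈ EW) ANode.bot v ∧
      ∀ w, (v, r, w) ∉ EW
  then h.exists.choose
  else ANode.bot

/-- `max_p(V) + 1`: one plus the largest `n` with `(p,n) ∈ V` (0 if none). -/
noncomputable def maxpSucc (V : Set ANode) (p : PID) : ℕ :=
  sSup {m : ℕ | ∃ n, m = n + 1 ∧ ANode.node p n ∈ V}

/-- `max_p(V)` as an integer, −1 if no `(p,n) ∈ V`. -/
noncomputable def maxp (V : Set ANode) (p : PID) : ℤ :=
  (maxpSucc V p : ℤ) - 1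

/-- Labels (p, Rd, Wt). -/
abbrev Label (R : Type) := PID × Set R × Set R

/-- Forward annotation transition A₁ ⇀(p,Rd,Wt) A₂. -/
def Step {R : Type} (A₁ A₂ : AnnDAG R) (p : PID) (Rd Wt : Set R) : Prop :=
  A₂.V = A₁.V ∪ {ANode.node p (maxpSucc A₁.V p)} ∧
  A₂.ER = A₁.ER ∪
    {e | ∃ r ∈ Rd \ Wt, e = (lastN A₁.EW r, r, ANode.node p (maxpSucc A₁.V p))} ∧
  A₂.EW = A₁.EW ∪
    {e | ∃ r ∈ Wt, e = (lastN A₁.EW r, r, ANode.node p (maxpSucc A₁.V p))}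

/-- Forward transition with some label. -/
def StepAny {R : Type} (A₁ A₂ : AnnDAG R) : Prop := ∃ p Rd Wt, Step A₁ A₂ p Rd Wt

/-- Forward transition with some label in `O`. -/
def StepIn {R : Type} (O : Set (Label R)) (A₁ A₂ : AnnDAG R) : Prop :=
  ∃ l ∈ O, Step A₁ A₂ l.1 l.2.1 l.2.2

/-- The initial annotation DAG ({⊥}, ∅, ∅). -/
def Ainit (R : Type) : AnnDAG R where
  V := {ANode.bot}
  ER := ∅
  EW := ∅
  finV := Set.finite_singleton _
  bot_mem := rfl
  down := by intro p n h; simp at h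
  edges_sub := by intro e he; simp at he
  in_unique := by intro v' v'' r v h; simp at h
  disj := by simp
  acyclic := by
    intro v h
    have hne : ∀ a b : ANode, ¬ ∃ r : R, (a, r, b) ∈ (∅ ∪ ∅ : Set (AEdge R)) := by simp
    cases h with
    | single h' => exact hne _ _ h'
    | tail _ h' => exact hne _ _ h'
  w_pred := by intro v' r v h; simp at h
  w_out_unique := by intro v r v' v'' h; simp at h

/-- Signed labels: forward or underlined (backward). -/
inductive SLabel (R : Type) where
  | fwd : Label R → SLabel R
  | bwd : Label R → SLabel R

/-- `und`: forget the underline. -/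
def und {R : Type} : SLabel R → Label R
  | .fwd a => a
  | .bwd a => a

/-- The underline-toggle. -/
def toggle {R : Type} : SLabel R → SLabel R
  | .fwd a => .bwd a
  | .bwd a => .fwd a

/-- Combined transitions: forward, or reversed forward. -/
def CStep {R : Type} (A A' : AnnDAG R) : SLabel R → Prop
  | .fwd a => Step A A' a.1 a.2.1 a.2.2
  | .bwd a => Step A' A a.1 a.2.1 a.2.2

/-- Independence of signed labels: incomparable pids and disjoint read/write sets. -/
def indepLab {R : Type} (α β : SLabel R) : Prop :=
  ¬ (und α).1 <+: (und β).1 ∧ ¬ (und β).1 <+: (und α).1 ∧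
  (und α).2.1 ∩ (und β).2.2 = ∅ ∧ (und β).2.1 ∩ (und α).2.2 = ∅

/-- `diff` of a combined transition. -/
def diff {R : Type} (A A' : AnnDAG R) (α : SLabel R) :
    Set ANode × Set (AEdge R) × Set (AEdge R) :=
  match α with
  | .fwd _ => (A'.V \ A.V, A'.ER \ A.ER, A'.EW \ A.EW)
  | .bwd _ => (A.V \ A'.V, A.ER \ A'.ER, A.EW \ A'.EW)

/-- The underlying triple of an annotation DAG. -/
def triple {R : Type} (A : AnnDAG R) : Set ANode × Set (AEdge R) × Set (AEdge R) :=
  (A.V, A.ER, A.EW)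

/-- The ⊙^α operation on triples. -/
def odot {R : Type} (α : SLabel R)
    (T Δ : Set ANode × Set (AEdge R) × Set (AEdge R)) :
    Set ANode × Set (AEdge R) × Set (AEdge R) :=
  match α with
  | .fwd _ => (T.1 ∪ Δ.1, T.2.1 ∪ Δ.2.1, T.2.2 ∪ Δ.2.2)
  | .bwd _ => (T.1 \ Δ.1, T.2.1 \ Δ.2.1, T.2.2 \ Δ.2.2)


/-- The new nodes of a forward step, and the targets of its new edges, all carry its pid. -/
theorem Step.pid_of_new {R : Type} {A₁ A₂ : AnnDAG R} {p : PID} {Rd Wt : Set R}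
    (h : Step A₁ A₂ p Rd Wt) :
    (∀ v ∈ A₂.V \ A₁.V, ∃ n, v = ANode.node p n) ∧
    (∀ e ∈ A₂.ER \ A₁.ER, ∃ n, e.2.2 = ANode.node p n) ∧
    (∀ e ∈ A₂.EW \ A₁.EW, ∃ n, e.2.2 = ANode.node p n) := by
  obtain ⟨hV, hR, hW⟩ := h
  rw [hV, hR, hW]
  refine ⟨?_, ?_, ?_⟩
  · rintro v ⟨hv | hv, hn⟩
    · exact absurd hv hn
    · exact ⟨_, hv⟩
  all_goals
    rintro e ⟨he | ⟨r, -, rfl⟩, hn⟩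
    · exact absurd he hn
    · exact ⟨_, rfl⟩

/-- The nodes of a diff, and the targets of its edges, all carry the pid of the label. -/
theorem CStep.pid_of_mem_diff {R : Type} {A A' : AnnDAG R} {α : SLabel R} (h : CStep A A' α) :
    (∀ v ∈ (diff A A' α).1, ∃ n, v = ANode.node (und α).1 n) ∧
    (∀ e ∈ (diff A A' α).2.1, ∃ n, e.2.2 = ANode.node (und α).1 n) ∧
    (∀ e ∈ (diff A A' α).2.2, ∃ n, e.2.2 = ANode.node (und α).1 n) := by
  cases α with
  | fwd a => exact Step.pid_of_new h
  | bwd a => exact Step.pid_of_new h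

/-- the diffs of coinitial combined annotation transitions with
independent labels are componentwise disjoint. -/
theorem stmt5 {R : Type} {A A' A'' : AnnDAG R} {α β : SLabel R}
    (h1 : CStep A A' α) (h2 : CStep A A'' β) (h : indepLab α β) :
    (diff A A' α).1 ∩ (diff A A'' β).1 = ∅ ∧
    (diff A A' α).2.1 ∩ (diff A A'' β).2.1 = ∅ ∧
    (diff A A' α).2.2 ∩ (diff A A'' β).2.2 = ∅ := by
  obtain ⟨hV, hR, hW⟩ := h1.pid_of_mem_diff
  obtain ⟨hV', hR', hW'⟩ := h2.pid_of_mem_diff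
  have hp (v : ANode) (hα : ∃ n, v = ANode.node (und α).1 n)
      (hβ : ∃ n, v = ANode.node (und β).1 n) : False := by
    obtain ⟨n, rfl⟩ := hα
    obtain ⟨m, hm⟩ := hβ
    exact h.1 ((ANode.node.inj hm).1 ▸ List.prefix_rfl)
  simp only [Set.eq_empty_iff_forall_notMem]
  exact ⟨fun v hv => hp v (hV v hv.1) (hV' v hv.2),
    fun e he => hp e.2.2 (hR e he.1) (hR' e he.2),
    fun e he => hp e.2.2 (hW e he.1) (hW' e he.2)⟩

end CRIL
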